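/- Let n ≥ 1 be an integer and fix s > 0. Define y : (0,∞) → ℝ by y(t) = (1/(n−1)!)·((t^α − s^α)/(λα))^{n−1}. Then y is n times α-differentiable, D_α^n y(t) = 0 for all t > 0, D_α^j y(s) = 0 for every 0 ≤ j ≤ n−2, and D_α^{n−1} y(s) = 1 (i.e., y is the Cauchy function of the n-th order truncated V-fractional equation D_α^n y = 0). -/

import Mathlib

open Real Set MeasureTheory Filter

noncomputable def poch (x y : ℝ) : ℝ := Real.Gamma (x + y) / Real.Gamma x

noncomputable def vlam (γ β ρ δ p q : ℝ) : ℝ :=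
  (Real.Gamma β * poch ρ q) / (Real.Gamma (γ + β) * poch δ p)

/-- Truncated V-fractional derivative `D_α f t = λ t^(1-α) f' t`. -/
noncomputable def Dal (γ β ρ δ p q α : ℝ) (f : ℝ → ℝ) : ℝ → ℝ :=
  fun t => vlam γ β ρ δ p q * t ^ (1 - α) * deriv f t

/-- `f` is `k` times α-differentiable. -/
def alphaDiff (γ β ρ δ p q α : ℝ) (k : ℕ) (f : ℝ → ℝ) : Prop :=
  ∀ j < k, DifferentiableOn ℝ ((Dal γ β ρ δ p q α)^[j] f) (Set.Ioi 0)

/-- V-fractional integral `∫_a^b f dω = λ⁻¹ ∫_a^b f x · x^(α-1) dx`. -/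
noncomputable def VInt (γ β ρ δ p q α : ℝ) (a b : ℝ) (f : ℝ → ℝ) : ℝ :=
  (vlam γ β ρ δ p q)⁻¹ * ∫ x in a..b, f x * x ^ (α - 1)

/-- Truncated V-fractional Taylor remainder with `m` terms; `R_{n,f} = Rtay (n+1)`. -/
noncomputable def Rtay (γ β ρ δ p q α : ℝ) (m : ℕ) (f : ℝ → ℝ) (t s : ℝ) : ℝ :=
  f s - ∑ k ∈ Finset.range m,
    ((Dal γ β ρ δ p q α)^[k] f t / (Nat.factorial k : ℝ)) *
      ((s ^ α - t ^ α) / (vlam γ β ρ δ p q * α)) ^ k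

lemma poch_pos {x y : ℝ} (hx : 0 < x) (hy : 0 < y) : 0 < poch x y :=
  div_pos (Real.Gamma_pos_of_pos (add_pos hx hy)) (Real.Gamma_pos_of_pos hx)

lemma vlam_pos {γ β ρ δ p q : ℝ} (hγ : 0 < γ) (hβ : 0 < β) (hρ : 0 < ρ) (hδ : 0 < δ)
    (hp : 0 < p) (hq : 0 < q) : 0 < vlam γ β ρ δ p q :=
  div_pos (mul_pos (Real.Gamma_pos_of_pos hβ) (poch_pos hρ hq))
    (mul_pos (Real.Gamma_pos_of_pos (add_pos hγ hβ)) (poch_pos hδ hp))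

lemma hasDerivAt_rpow_sub_div {l α t : ℝ} (hα : α ≠ 0) (ht : 0 < t) (c : ℝ) :
    HasDerivAt (fun x : ℝ => (x ^ α - c) / (l * α)) (t ^ (α - 1) / l) t := by
  have h := ((Real.hasDerivAt_rpow_const (p := α) (Or.inl ht.ne')).sub_const c).div_const (l * α)
  rwa [mul_comm l α, mul_div_mul_left _ _ hα, mul_comm α l] at h

/-- On `(0, ∞)`, `Dal` only depends on the values of the function there. -/
lemma Dal_congr {γ β ρ δ p q α : ℝ} {f g : ℝ → ℝ} (h : ∀ t > 0, f t = g t) {t : ℝ}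
    (ht : 0 < t) : Dal γ β ρ δ p q α f t = Dal γ β ρ δ p q α g t := by
  have hfg : f =ᶠ[nhds t] g := by
    filter_upwards [Ioi_mem_nhds ht] with x hx using h x hx
  simp only [Dal, hfg.deriv_eq]

lemma Dal_pow_div_factorial {γ β ρ δ p q α : ℝ} (hl : vlam γ β ρ δ p q ≠ 0) (hα : α ≠ 0)
    (c : ℝ) (m : ℕ) {t : ℝ} (ht : 0 < t) :
    Dal γ β ρ δ p q α (fun x => 1 / (Nat.factorial (m + 1) : ℝ) *
      ((x ^ α - c) / (vlam γ β ρ δ p q * α)) ^ (m + 1)) t =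
    1 / (Nat.factorial m : ℝ) * ((t ^ α - c) / (vlam γ β ρ δ p q * α)) ^ m := by
  have h := ((hasDerivAt_rpow_sub_div (l := vlam γ β ρ δ p q) hα ht c).pow (m + 1)).const_mul
    (1 / (Nat.factorial (m + 1) : ℝ))
  have ht1 : t ^ (1 - α) * t ^ (α - 1) = 1 := by
    rw [← Real.rpow_add ht]; simp
  have hm : (Nat.factorial m : ℝ) ≠ 0 := by positivity
  have hm1 : (m : ℝ) + 1 ≠ 0 := by positivity
  have hd := h.deriv
  simp only [Pi.pow_apply] at hd
  simp only [Dal]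
  erw [hd]
  rw [Nat.factorial_succ, Nat.add_sub_cancel]
  push_cast
  generalize (t ^ α - c) / (vlam γ β ρ δ p q * α) = u
  calc _ = (t ^ (1 - α) * t ^ (α - 1)) * (1 / (Nat.factorial m : ℝ) * u ^ m) := by
        field_simp
    _ = _ := by rw [ht1, one_mul]

lemma Dal_iterate_pow_div_factorial {γ β ρ δ p q α : ℝ} (hl : vlam γ β ρ δ p q ≠ 0)
    (hα : α ≠ 0) (c : ℝ) (j k : ℕ) : ∀ t > 0,
    (Dal γ β ρ δ p q α)^[j] (fun x => 1 / (Nat.factorial (j + k) : ℝ) *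
      ((x ^ α - c) / (vlam γ β ρ δ p q * α)) ^ (j + k)) t =
    1 / (Nat.factorial k : ℝ) * ((t ^ α - c) / (vlam γ β ρ δ p q * α)) ^ k := by
  induction j generalizing k with
  | zero => simp
  | succ j ih =>
    intro t ht
    rw [Function.iterate_succ_apply', Nat.succ_add_eq_add_succ,
      Dal_congr (ih (k + 1)) ht, Dal_pow_div_factorial hl hα c k ht]

theorem stmt0 (γ β ρ δ p q α : ℝ) (hγ : 0 < γ) (hβ : 0 < β) (hρ : 0 < ρ) (hδ : 0 < δ)
    (hp : 0 < p) (hq : 0 < q) (hα : 0 < α) (hα1 : α ≤ 1)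
    (n : ℕ) (hn : 1 ≤ n) (s : ℝ) (hs : 0 < s)
    (y : ℝ → ℝ)
    (hy : ∀ t : ℝ, y t = (1 / (Nat.factorial (n - 1) : ℝ)) *
      ((t ^ α - s ^ α) / (vlam γ β ρ δ p q * α)) ^ (n - 1)) :
    alphaDiff γ β ρ δ p q α n y ∧
    (∀ t > (0 : ℝ), (Dal γ β ρ δ p q α)^[n] y t = 0) ∧
    (∀ j : ℕ, j + 2 ≤ n → (Dal γ β ρ δ p q α)^[j] y s = 0) ∧
    (Dal γ β ρ δ p q α)^[n - 1] y s = 1 := by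
  obtain ⟨m, rfl⟩ : ∃ m, n = m + 1 := ⟨n - 1, by omega⟩
  rw [Nat.add_sub_cancel] at hy ⊢
  have hl := (vlam_pos hγ hβ hρ hδ hp hq).ne'
  have key : ∀ j ≤ m, ∀ t > 0, (Dal γ β ρ δ p q α)^[j] y t = 1 / (Nat.factorial (m - j) : ℝ) *
      ((t ^ α - s ^ α) / (vlam γ β ρ δ p q * α)) ^ (m - j) := by
    intro j hj t ht
    have h := Dal_iterate_pow_div_factorial hl hα.ne' (s ^ α) j (m - j) t ht
    rwa [Nat.add_sub_of_le hj, ← funext hy] at h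
  refine ⟨fun j hj t ht => ?_, fun t ht => ?_, fun j hj => ?_, ?_⟩
  · have hd := ((hasDerivAt_rpow_sub_div (l := vlam γ β ρ δ p q) hα.ne' ht (s ^ α)).pow
      (m - j)).const_mul (1 / (Nat.factorial (m - j) : ℝ))
    exact hd.differentiableAt.differentiableWithinAt.congr (key j (by omega))
      (key j (by omega) t ht)
  · rw [Function.iterate_succ_apply', Dal_congr (key m le_rfl) ht]
    simp [Dal]
  · rw [key j (by omega) s hs, sub_self, zero_div, zero_pow (by omega), mul_zero]
  · simp [key m le_rfl s hs]
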